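/- Let K be a field of characteristic zero and X a rank-two irreducible locally nilpotent K-derivation of K[x,y,z]. Write K[x,y,z]^X = K[u,p] where u is a coordinate of K[x,y,z], let s be a minimal local slice of X with X(s) = c(u), and suppose H = p + Q(u, s + ℓ(u,p)) belongs to I_c^X = c·K[x,y,z] ∩ K[u,p,s], where Q and ℓ are polynomials in one variable with coefficients in K[u]. Set v = s + ℓ(u,p) and let w ∈ K[x,y,z] be such that H = c(u)·w. Then u,v,w is a coordinate system of K[x,y,z] and X(u) = 0, X(v) = c(u), X(w) = ∂_v Q(u,v). -/

import Mathlib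

noncomputable section

variable (K : Type) [Field K] [CharZero K]

abbrev PolyR (K : Type) [Field K] : Type := MvPolynomial (Fin 3) K

/-- A derivation is locally nilpotent if every element is killed by some iterate. -/
def LND (X : Derivation K (PolyR K) (PolyR K)) : Prop :=
  ∀ a : PolyR K, ∃ n : ℕ, 0 < n ∧ (⇑X)^[n] a = 0

/-- `X` is irreducible: every common divisor of `X x, X y, X z` is a unit. -/
def IrredDer (X : Derivation K (PolyR K) (PolyR K)) : Prop :=
  ∀ d : PolyR K, (∀ i : Fin 3, d ∣ X (MvPolynomial.X i)) → IsUnit d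

def IsCoord (f : PolyR K) : Prop :=
  ∃ g h : PolyR K, Algebra.adjoin K {f, g, h} = ⊤

def IsCoordSys (u v w : PolyR K) : Prop := Algebra.adjoin K {u, v, w} = ⊤

def IsSysOfCoords2 (u v : PolyR K) : Prop :=
  ∃ w : PolyR K, Algebra.adjoin K {u, v, w} = ⊤

/-- The corank of a derivation: the largest length of a system of coordinates in the kernel. -/
def corank (X : Derivation K (PolyR K) (PolyR K)) : ℕ :=
  sSup {r : ℕ | ∃ l : List (PolyR K), l.length = r ∧ (∀ f ∈ l, X f = 0) ∧
    ∃ m : List (PolyR K), (l ++ m).length = 3 ∧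
      Algebra.adjoin K {a : PolyR K | a ∈ l ++ m} = ⊤}

def rankD (X : Derivation K (PolyR K) (PolyR K)) : ℕ := 3 - corank K X

def IsLocalSlice (X : Derivation K (PolyR K) (PolyR K)) (s : PolyR K) : Prop :=
  X s ≠ 0 ∧ X (X s) = 0

def IsMinLocalSlice (X : Derivation K (PolyR K) (PolyR K)) (s : PolyR K) : Prop :=
  IsLocalSlice K X s ∧ ∀ v : PolyR K, IsLocalSlice K X v → X v ∣ X s →
    ∃ μ : (PolyR K)ˣ, X v = (μ : PolyR K) * X s

/-- `c` generates the plinth ideal `S^X = {X a : X² a = 0}` as an ideal of the constants. -/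
def IsPlinthGen (X : Derivation K (PolyR K) (PolyR K)) (c : PolyR K) : Prop :=
  {d : PolyR K | ∃ a : PolyR K, X a = d ∧ X (X a) = 0} =
    {d : PolyR K | ∃ r : PolyR K, X r = 0 ∧ d = r * c}

/-- `X` is triangulable: triangular in some coordinate system. -/
def Triangulable (X : Derivation K (PolyR K) (PolyR K)) : Prop :=
  ∃ u v w : PolyR K, IsCoordSys K u v w ∧
    X u ∈ (⊥ : Subalgebra K (PolyR K)) ∧
    X v ∈ Algebra.adjoin K {u} ∧
    X w ∈ Algebra.adjoin K {u, v}

/-- Evaluation of `Q ∈ K[u][T]` at `T = t`, with coefficients evaluated at `u`. -/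
def ev2 (u t : PolyR K) (Q : Polynomial (Polynomial K)) : PolyR K :=
  Polynomial.eval₂ (Polynomial.aeval u).toRingHom t Q

/-- The Jacobian derivation `Jac(f,g,·)` applied to `h`. -/
def jacDet (f g h : PolyR K) : PolyR K :=
  Matrix.det !![MvPolynomial.pderiv 0 f, MvPolynomial.pderiv 1 f, MvPolynomial.pderiv 2 f;
    MvPolynomial.pderiv 0 g, MvPolynomial.pderiv 1 g, MvPolynomial.pderiv 2 g;
    MvPolynomial.pderiv 0 h, MvPolynomial.pderiv 1 h, MvPolynomial.pderiv 2 h]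



theorem indep3 {K : Type} [Field K] (a b d : PolyR K)
    (h : ∀ f : PolyR K, ∃ e : PolyR K, e ≠ 0 ∧ e ∈ Algebra.adjoin K {a, b, d} ∧
      e * f ∈ Algebra.adjoin K {a, b, d}) :
    AlgebraicIndependent K ![a, b, d] := by
  classical
  have hal : Algebra.IsAlgebraic (Algebra.adjoin K ({a, b, d} : Set (PolyR K))) (PolyR K) := by
    refine ⟨fun f => ?_⟩
    obtain ⟨e, he0, he, hef⟩ := h f
    refine ⟨Polynomial.C ⟨e, he⟩ * Polynomial.X - Polynomial.C ⟨e * f, hef⟩, ?_, ?_⟩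
    · intro h0
      have := congrArg (fun P => Polynomial.coeff P 1) h0
      simp at this
      exact he0 (congrArg Subtype.val this)
    · simp [Algebra.algebraMap_eq_smul_one, Subalgebra.smul_def]
  obtain ⟨t, ht, hb⟩ := exists_isTranscendenceBasis_subset (R := K) ({a, b, d} : Set (PolyR K))
  have hX : IsTranscendenceBasis K (MvPolynomial.X : Fin 3 → PolyR K) :=
    IsTranscendenceBasis.mvPolynomial _ _
  have hcard := hb.cardinalMk_eq hX
  have hfin : t.Finite := Set.Finite.subset (by simp) ht
  have hn : t.ncard = 3 := by
    have : Nat.card t = 3 := by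
      rw [Nat.card, hcard]; simp
    simpa [Nat.card_coe_set_eq] using this
  have hle : ({a, b, d} : Set (PolyR K)).ncard ≤ 3 := by
    have := Set.ncard_insert_le a ({b, d} : Set (PolyR K))
    have := Set.ncard_insert_le b ({d} : Set (PolyR K))
    have := Set.ncard_singleton d
    omega
  have hteq : t = {a, b, d} := Set.eq_of_subset_of_ncard_le ht (by omega) (by simp)
  subst hteq
  have hab : a ≠ b ∧ a ≠ d ∧ b ≠ d := by
    have hp : ∀ x y : PolyR K, ({x, y} : Set (PolyR K)).ncard ≤ 2 := fun x y => by
      have := Set.ncard_insert_le x ({y} : Set (PolyR K))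
      have := Set.ncard_singleton y
      omega
    refine ⟨?_, ?_, ?_⟩
    · rintro rfl
      have := hp a d
      simp only [Set.insert_eq_of_mem, Set.mem_insert_iff, true_or] at hn
      omega
    · rintro rfl
      have := hp b a
      rw [Set.insert_eq_of_mem (by simp)] at hn
      omega
    · rintro rfl
      have := hp a b
      rw [Set.insert_eq_of_mem (a := b) (s := {b}) (by simp)] at hn
      omega
  have hinj : Function.Injective ![a, b, d] := by
    obtain ⟨h1, h2, h3⟩ := hab
    intro i j hij
    fin_cases i <;> fin_cases j <;> simp_all
    all_goals (exact absurd hij.symm (by assumption))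
  have hr : Set.range ![a, b, d] = {a, b, d} := by
    ext x; simp [eq_comm]; tauto
  rw [← algebraicIndependent_subtype_range hinj, hr]
  exact hb.1

theorem indep_top {K : Type} [Field K] (a b d : PolyR K)
    (h : Algebra.adjoin K {a, b, d} = ⊤) : AlgebraicIndependent K ![a, b, d] :=
  indep3 a b d fun f => ⟨1, one_ne_zero, one_mem _, by rw [h]; trivial⟩

/-- The reduction of the polynomial ring modulo an irreducible polynomial in a coordinate. -/
theorem exists_reduction {K : Type} [Field K] (u : PolyR K) (hu : IsCoord K u)
    (q : Polynomial K) (hq : Irreducible q) :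
    Prime (Polynomial.aeval u q) ∧
    ∀ (v : PolyR K) (P : Polynomial (Polynomial K)), ¬ Polynomial.C q ∣ P →
      Polynomial.aeval u q ∣ ev2 K u v P → ∃ r : Polynomial K,
        Polynomial.aeval u q ∣ v - Polynomial.aeval u r := by
  classical
  obtain ⟨g, h, hgh⟩ := hu
  have hi := indep_top u g h hgh
  have hr : Set.range ![u, g, h] = {u, g, h} := by
    ext x; simp [eq_comm]; tauto
  have hbij : Function.Bijective (MvPolynomial.aeval ![u, g, h] : PolyR K →ₐ[K] PolyR K) := by
    refine ⟨hi, ?_⟩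
    rw [← AlgHom.range_eq_top, ← Algebra.adjoin_range_eq_range_aeval, hr, hgh]
  let φ : PolyR K ≃ₐ[K] PolyR K := AlgEquiv.ofBijective _ hbij
  let E : PolyR K ≃ₐ[K] MvPolynomial (Fin 2) (Polynomial K) :=
    φ.symm.trans ((MvPolynomial.renameEquiv K (_root_.finSuccEquiv 2)).trans
      (MvPolynomial.optionEquivRight K (Fin 2)))
  have hEu : E u = MvPolynomial.C Polynomial.X := by
    have : φ.symm u = MvPolynomial.X 0 := by
      rw [AlgEquiv.symm_apply_eq]; simp [φ]
    simp [E, this]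
  clear_value E
  have hEa : ∀ f : Polynomial K, E (Polynomial.aeval u f) = MvPolynomial.C f := by
    intro f
    have h1 : (E.toAlgHom.comp (Polynomial.aeval u)) =
        (IsScalarTower.toAlgHom K (Polynomial K) (MvPolynomial (Fin 2) (Polynomial K))) := by
      ext; simp [hEu, MvPolynomial.algebraMap_eq]
    exact DFunLike.congr_fun h1 f
  have hdvd : ∀ f : PolyR K, Polynomial.aeval u q ∣ f ↔ MvPolynomial.C q ∣ E f := by
    intro f
    rw [← hEa, map_dvd_iff E]
  have : Fact (Irreducible q) := ⟨hq⟩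
  have hmap : ∀ F : MvPolynomial (Fin 2) (Polynomial K),
      MvPolynomial.C q ∣ F ↔ MvPolynomial.map (AdjoinRoot.mk q) F = 0 := by
    intro F
    rw [MvPolynomial.C_dvd_iff_dvd_coeff, MvPolynomial.ext_iff]
    simp [MvPolynomial.coeff_map, AdjoinRoot.mk_eq_zero]
  refine ⟨?_, ?_⟩
  · rw [← MulEquiv.prime_iff E.toMulEquiv]
    have : E.toMulEquiv (Polynomial.aeval u q) = MvPolynomial.C q := hEa q
    have h2 : E (Polynomial.aeval u q) = MvPolynomial.C q := hEa q
    show Prime (E (Polynomial.aeval u q))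
    rw [h2, MvPolynomial.prime_C_iff]
    exact hq.prime
  · intro v P hP hd
    rw [hdvd, hmap] at hd
    set χ : PolyR K →+* MvPolynomial (Fin 2) (AdjoinRoot q) :=
      (MvPolynomial.map (AdjoinRoot.mk q)).comp (E : PolyR K →+* _) with hχ
    have hχa : ∀ f : PolyR K, MvPolynomial.map (AdjoinRoot.mk q) (E f) = χ f := fun f => rfl
    have hχu : χ.comp (Polynomial.aeval u).toRingHom =
        (algebraMap (AdjoinRoot q) (MvPolynomial (Fin 2) (AdjoinRoot q))).comp
          (AdjoinRoot.mk q) := by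
      refine RingHom.ext fun f => ?_
      change MvPolynomial.map (AdjoinRoot.mk q) (E (Polynomial.aeval u f)) = _
      rw [hEa, MvPolynomial.map_C]
      rfl
    set vb := χ v with hvb
    have hev : χ (ev2 K u v P) =
        Polynomial.aeval vb (P.map (AdjoinRoot.mk q)) := by
      rw [Polynomial.aeval_def, Polynomial.eval₂_map, ev2, Polynomial.hom_eval₂, hχu]
    rw [hχa] at hd
    rw [hev] at hd
    have hne : P.map (AdjoinRoot.mk q) ≠ 0 := by
      intro h0
      apply hP
      rw [Polynomial.C_dvd_iff_dvd_coeff]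
      intro i
      have := congrArg (fun R => Polynomial.coeff R i) h0
      simpa [Polynomial.coeff_map, AdjoinRoot.mk_eq_zero] using this
    have halg : IsAlgebraic (AdjoinRoot q) vb := ⟨_, hne, hd⟩
    have hconst : ∃ l, vb = MvPolynomial.C l := by
      by_cases h0 : vb = 0
      · exact ⟨0, by simp [h0]⟩
      obtain ⟨y, hy0, hy⟩ := halg.exists_nonzero_dvd (mem_nonZeroDivisors_of_ne_zero h0)
      have hun : IsUnit vb := isUnit_of_dvd_unit hy ((IsUnit.mk0 y hy0).map _)
      rw [MvPolynomial.isUnit_iff_totalDegree_of_isReduced] at hun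
      exact ⟨_, MvPolynomial.totalDegree_eq_zero_iff_eq_C.1 hun.2⟩
    obtain ⟨l, hl⟩ := hconst
    obtain ⟨r, rfl⟩ := AdjoinRoot.mk_surjective l
    refine ⟨r, ?_⟩
    rw [hdvd, hmap]
    rw [map_sub, map_sub, hχa, ← hvb, hl, hEa, MvPolynomial.map_C, sub_self]

/-- Chain rule modulo `q`. -/
theorem chain_mod {K R A : Type} [CommRing R] [Field K] [CommRing A] [Algebra K A]
    (D : Derivation K A A) (ψ : R →+* A) (q : A) (hψ : ∀ r, q ∣ D (ψ r)) (w : A)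
    (F : Polynomial R) :
    q ∣ D (F.eval₂ ψ w) - (Polynomial.derivative F).eval₂ ψ w * D w := by
  induction F using Polynomial.induction_on' with
  | add f g hf hg =>
    have := dvd_add hf hg
    simp only [Polynomial.eval₂_add, map_add]
    convert this using 1; ring
  | monomial n a =>
    have : D (Polynomial.eval₂ ψ w (Polynomial.monomial n a)) -
      (Polynomial.derivative (Polynomial.monomial n a)).eval₂ ψ w * D w = w ^ n * D (ψ a) := by
      simp [Polynomial.derivative_monomial, Polynomial.eval₂_monomial, Derivation.leibniz,
        Derivation.leibniz_pow]
      ring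
    rw [this]
    exact (hψ a).mul_left _

theorem dvd_of_derivative {K R : Type} [Field K] [CharZero K] [CommRing R] [Algebra K R] (q : R)
    (F : Polynomial R) (h : Polynomial.C q ∣ Polynomial.derivative F) :
    ∃ G, F = Polynomial.C (F.coeff 0) + Polynomial.C q * G := by
  have : Polynomial.C q ∣ F - Polynomial.C (F.coeff 0) := by
    rw [Polynomial.C_dvd_iff_dvd_coeff] at h ⊢
    intro i
    cases i with
    | zero => simp
    | succ n =>
      have h1 := h n
      rw [Polynomial.coeff_derivative] at h1
      have h2 : F.coeff (n + 1) = (F.coeff (n + 1) * ((n : R) + 1)) *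
          algebraMap K R (((n : K) + 1)⁻¹) := by
        have : ((n : R) + 1) = algebraMap K R ((n : K) + 1) := by simp
        rw [this, mul_assoc, ← map_mul, mul_inv_cancel₀ (Nat.cast_add_one_ne_zero n), map_one, mul_one]
      rw [Polynomial.coeff_sub, Polynomial.coeff_C_succ, sub_zero, h2]
      exact h1.mul_right _
  obtain ⟨G, hG⟩ := this
  exact ⟨G, by rw [← hG]; ring⟩

theorem int_slice {K : Type} [Field K] [CharZero K] (X : Derivation K (PolyR K) (PolyR K))
    (u p s : PolyR K) (hu : X u = 0) (hp : X p = 0) (P : PolyR K) :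
    ∃ P' : PolyR K, X (MvPolynomial.aeval ![u, p, s] P') =
      X s * MvPolynomial.aeval ![u, p, s] P := by
  induction P using MvPolynomial.induction_on' with
  | monomial m a =>
    refine ⟨MvPolynomial.C (a * ((m 2 : K) + 1)⁻¹) * MvPolynomial.X 0 ^ m 0 *
      MvPolynomial.X 1 ^ m 1 * MvPolynomial.X 2 ^ (m 2 + 1), ?_⟩
    have h1 : MvPolynomial.aeval ![u, p, s] (MvPolynomial.monomial m a) =
        algebraMap K (PolyR K) a * (u ^ m 0 * p ^ m 1 * s ^ m 2) := by
      rw [MvPolynomial.aeval_monomial, Finsupp.prod_fintype _ _ (by simp)]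
      simp [Fin.prod_univ_three]
    rw [h1]
    have hn : ((m 2 : K) + 1) ≠ 0 := Nat.cast_add_one_ne_zero _
    have h2 : algebraMap K (PolyR K) ((m 2 : K) + 1)⁻¹ * ((m 2 : PolyR K) + 1) = 1 := by
      have : ((m 2 : PolyR K) + 1) = algebraMap K (PolyR K) ((m 2 : K) + 1) := by simp
      rw [this, ← map_mul, inv_mul_cancel₀ hn, map_one]
    have h3 : X (MvPolynomial.aeval ![u, p, s] (MvPolynomial.C (a * ((m 2 : K) + 1)⁻¹) *
        MvPolynomial.X 0 ^ m 0 * MvPolynomial.X 1 ^ m 1 * MvPolynomial.X 2 ^ (m 2 + 1))) =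
        algebraMap K (PolyR K) a * (algebraMap K (PolyR K) ((m 2 : K) + 1)⁻¹ *
          ((m 2 : PolyR K) + 1)) * u ^ m 0 * p ^ m 1 * s ^ m 2 * X s := by
      simp only [map_mul, map_pow, MvPolynomial.aeval_C, MvPolynomial.aeval_X, Derivation.leibniz,
        Derivation.leibniz_pow, Derivation.map_algebraMap, Matrix.cons_val_zero,
        Matrix.cons_val_one, Matrix.cons_val, hu, hp, smul_eq_mul, nsmul_eq_mul]
      push_cast
      ring
    rw [h3, h2]
    ring
  | add f g hf hg =>
    obtain ⟨f', hf'⟩ := hf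
    obtain ⟨g', hg'⟩ := hg
    exact ⟨f' + g', by rw [map_add, map_add, hf', hg', map_add, mul_add]⟩

theorem adjoin3 {K : Type} [Field K] (a b d : PolyR K) :
    Algebra.adjoin K {a, b, d} =
      (MvPolynomial.aeval ![a, b, d] : PolyR K →ₐ[K] PolyR K).range := by
  have hr : Set.range ![a, b, d] = {a, b, d} := by
    ext x; simp [eq_comm]; tauto
  rw [← Algebra.adjoin_range_eq_range_aeval, hr]

theorem slice_loc {K : Type} [Field K] [CharZero K] (X : Derivation K (PolyR K) (PolyR K))
    (u p s : PolyR K) (hu : X u = 0) (hp : X p = 0)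
    (hker : ∀ a, X a = 0 → a ∈ Algebra.adjoin K {u, p})
    (hXs : X (X s) = 0) (n : ℕ) :
    ∀ a : PolyR K, (⇑X)^[n] a = 0 → ∃ N, (X s) ^ N * a ∈ Algebra.adjoin K {u, p, s} := by
  induction n with
  | zero =>
    intro a ha
    refine ⟨0, ?_⟩
    simp only [Function.iterate_zero, id] at ha
    simp [ha, zero_mem]
  | succ n ih =>
    intro a ha
    rw [Function.iterate_succ_apply] at ha
    obtain ⟨N, hN⟩ := ih _ ha
    rw [adjoin3] at hN
    obtain ⟨P, hP⟩ := hN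
    obtain ⟨P', hP'⟩ := int_slice X u p s hu hp P
    change MvPolynomial.aeval ![u, p, s] P = _ at hP
    refine ⟨N + 1, ?_⟩
    have h0 : X ((X s) ^ (N + 1) * a - MvPolynomial.aeval ![u, p, s] P') = 0 := by
      rw [map_sub, hP', hP, Derivation.leibniz, Derivation.leibniz_pow, hXs]
      simp only [smul_eq_mul, nsmul_eq_mul]
      ring
    have h1 := hker _ h0
    have h2 : MvPolynomial.aeval ![u, p, s] P' ∈ Algebra.adjoin K {u, p, s} := by
      rw [adjoin3]; exact ⟨P', rfl⟩
    have h3 : Algebra.adjoin K {u, p} ≤ Algebra.adjoin K {u, p, s} :=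
      Algebra.adjoin_mono (by intro x; simp; tauto)
    have := add_mem (h3 h1) h2
    simpa using this

theorem X_aeval {K : Type} [Field K] (X : Derivation K (PolyR K) (PolyR K))
    (u : PolyR K) (hu : X u = 0) (f : Polynomial K) : X (Polynomial.aeval u f) = 0 := by
  have := chain_mod X (algebraMap K (PolyR K)) 0 (by simp) u f
  rw [zero_dvd_iff, hu, mul_zero, sub_zero] at this
  exact this

theorem X_ev2 {K : Type} [Field K] (X : Derivation K (PolyR K) (PolyR K))
    (u t : PolyR K) (hu : X u = 0) (f : Polynomial (Polynomial K)) :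
    X (ev2 K u t f) = ev2 K u t (Polynomial.derivative f) * X t := by
  have := chain_mod X (Polynomial.aeval u).toRingHom 0 (fun r => by
    rw [zero_dvd_iff]; exact X_aeval X u hu r) t f
  rw [zero_dvd_iff, sub_eq_zero] at this
  exact this

/-- `p + r(u)` is not divisible by a nonconstant `q(u)` inside `K[u,p]`. -/
theorem p_not_dvd {K : Type} [Field K] (u p s : PolyR K)
    (hi : AlgebraicIndependent K ![u, p, s]) (q r : Polynomial K) (hq : ¬ IsUnit q)
    (p' : PolyR K) (hp' : p' ∈ Algebra.adjoin K {u, p})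
    (h : p + Polynomial.aeval u r = Polynomial.aeval u q * p') : False := by
  have hr : ({u, p} : Set (PolyR K)) = Set.range ![u, p] := by
    ext x; simp [eq_comm]; tauto
  rw [hr, Algebra.adjoin_range_eq_range_aeval] at hp'
  obtain ⟨G, hG⟩ := hp'
  change MvPolynomial.aeval ![u, p] G = p' at hG
  subst hG
  -- pull back to the polynomial ring
  let G' : PolyR K := MvPolynomial.aeval ![MvPolynomial.X 0, MvPolynomial.X 1] G
  have hG' : MvPolynomial.aeval ![u, p, s] G' = MvPolynomial.aeval ![u, p] G := by
    have : ((MvPolynomial.aeval ![u, p, s] : PolyR K →ₐ[K] PolyR K).comp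
        (MvPolynomial.aeval ![MvPolynomial.X 0, MvPolynomial.X 1])) =
        MvPolynomial.aeval ![u, p] := by
      ext i; fin_cases i <;> simp
    exact congrArg (fun f => f G) this
  have hU : ∀ f : Polynomial K, MvPolynomial.aeval ![u, p, s]
      (Polynomial.aeval (MvPolynomial.X 0 : PolyR K) f) = Polynomial.aeval u f := by
    intro f
    rw [← Polynomial.aeval_algHom_apply]; simp
  have key : (MvPolynomial.X 1 : PolyR K) + Polynomial.aeval (MvPolynomial.X 0 : PolyR K) r =
      Polynomial.aeval (MvPolynomial.X 0 : PolyR K) q * G' := by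
    apply hi
    rw [map_add, map_mul, hU, hU, hG', ← h]
    simp
  -- evaluate in `K[T][Y]`
  let θ : PolyR K →ₐ[K] Polynomial (Polynomial K) :=
    MvPolynomial.aeval ![Polynomial.C Polynomial.X, Polynomial.X, 0]
  have hθ : ∀ f : Polynomial K, θ (Polynomial.aeval (MvPolynomial.X 0 : PolyR K) f) =
      Polynomial.C f := by
    intro f
    rw [← Polynomial.aeval_algHom_apply]
    have : θ (MvPolynomial.X 0) = Polynomial.C Polynomial.X := by simp [θ]
    rw [this]
    have h2 := Polynomial.aeval_algHom_apply
      (IsScalarTower.toAlgHom K (Polynomial K) (Polynomial (Polynomial K))) Polynomial.X f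
    rw [Polynomial.aeval_X_left_apply] at h2
    exact h2
  have k2 := congrArg θ key
  rw [map_add, map_mul, hθ, hθ] at k2
  have h1 : θ (MvPolynomial.X 1) = Polynomial.X := by simp [θ]
  rw [h1] at k2
  have k3 := congrArg (fun f => Polynomial.coeff f 1) k2
  simp at k3
  exact hq (IsUnit.of_mul_eq_one _ k3.symm)

/-- If `H = p + Q(u, s + ℓ(u,p))` belongs to `I_c^X` and `H = c(u)·w`, then with
`v = s + ℓ(u,p)` the triple `u,v,w` is a coordinate system in which `X` is triangular,
with `X u = 0`, `X v = c(u)`, `X w = ∂_v Q(u,v)`. -/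
theorem triangulating_coordinates {K : Type} [Field K] [CharZero K]
    (X : Derivation K (PolyR K) (PolyR K))
    (hln : LND K X) (hirr : IrredDer K X) (hrk : rankD K X = 2)
    (u p : PolyR K) (hu : IsCoord K u)
    (hker : {a : PolyR K | X a = 0} = (Algebra.adjoin K {u, p} : Subalgebra K (PolyR K)))
    (s : PolyR K) (hs : IsMinLocalSlice K X s)
    (c : Polynomial K) (hc : X s = Polynomial.aeval u c)
    (Q ℓ : Polynomial (Polynomial K)) (w : PolyR K)
    (hmem : (p + ev2 K u (s + ev2 K u p ℓ) Q) ∈ Algebra.adjoin K {u, p, s})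
    (hH : p + ev2 K u (s + ev2 K u p ℓ) Q = Polynomial.aeval u c * w) :
    IsCoordSys K u (s + ev2 K u p ℓ) w ∧
    X u = 0 ∧ X (s + ev2 K u p ℓ) = Polynomial.aeval u c ∧
    X w = ev2 K u (s + ev2 K u p ℓ) (Polynomial.derivative Q) := by
  obtain ⟨⟨hXs0, hXXs⟩, hmin⟩ := hs
  have hker1 : ∀ a, X a = 0 → a ∈ Algebra.adjoin K {u, p} := fun a ha => by
    have : a ∈ {a : PolyR K | X a = 0} := ha
    rw [hker] at this; exact this
  have hker2 : ∀ a, a ∈ Algebra.adjoin K {u, p} → X a = 0 := fun a ha => by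
    have : a ∈ {a : PolyR K | X a = 0} := by rw [hker]; exact ha
    exact this
  have hXu : X u = 0 := hker2 _ (Algebra.subset_adjoin (by simp))
  have hXp : X p = 0 := hker2 _ (Algebra.subset_adjoin (by simp))
  have hc0 : Polynomial.aeval u c ≠ 0 := hc ▸ hXs0
  have hXv : X (s + ev2 K u p ℓ) = Polynomial.aeval u c := by
    rw [map_add, X_ev2 X u p hXu, hXp, mul_zero, add_zero, hc]
  have hvdef : s = (s + ev2 K u p ℓ) - ev2 K u p ℓ := by ring
  generalize hv : s + ev2 K u p ℓ = v at *
  have hXw : X w = ev2 K u v (Polynomial.derivative Q) := by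
    have := congrArg X hH
    rw [map_add, X_ev2 X u v hXu, hXp, hXv, Derivation.leibniz, X_aeval X u hXu] at this
    simp only [smul_eq_mul, mul_zero, zero_add, add_zero] at this
    exact (mul_left_cancel₀ hc0 (by rw [← this]; ring))
  refine ⟨?_, hXu, hXv, hXw⟩
  have hloc : ∀ a : PolyR K, ∃ N, (Polynomial.aeval u c) ^ N * a ∈
      Algebra.adjoin K {u, p, s} := by
    intro a
    obtain ⟨n, -, hn⟩ := hln a
    rw [← hc]
    exact slice_loc X u p s hXu hXp hker1 hXXs n a hn
  have hau : ∀ (S : Set (PolyR K)) (f : Polynomial K), u ∈ S →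
      Polynomial.aeval u f ∈ Algebra.adjoin K S := by
    intro S f hS
    have h1 : Polynomial.aeval u f ∈ Algebra.adjoin K {u} := by
      rw [Algebra.adjoin_singleton_eq_range_aeval]; exact ⟨f, rfl⟩
    exact Algebra.adjoin_mono (by simpa using hS) h1
  have hev : ∀ (S : Set (PolyR K)) (t : PolyR K) (f : Polynomial (Polynomial K)), u ∈ S →
      t ∈ Algebra.adjoin K S → ev2 K u t f ∈ Algebra.adjoin K S := by
    intro S t f hS ht
    rw [ev2, Polynomial.eval₂_eq_sum_range]
    exact sum_mem fun i _ => mul_mem (hau S _ hS) (pow_mem ht i)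
  have hind : AlgebraicIndependent K ![u, p, s] := by
    refine indep3 u p s fun f => ?_
    obtain ⟨N, hN⟩ := hloc f
    exact ⟨_, pow_ne_zero N hc0, pow_mem (hau _ _ (by simp)) N, hN⟩
  -- the subalgebra `B`
  set ψ : Polynomial (Polynomial K) →+* PolyR K :=
    Polynomial.eval₂RingHom (Polynomial.aeval u).toRingHom v with hψ
  have hψe : ∀ P, ψ P = ev2 K u v P := fun P => rfl
  have hψC : ∀ f, ψ (Polynomial.C f) = Polynomial.aeval u f := fun f => by
    simp [hψ]
  have hB1 : ∀ F : Polynomial (Polynomial (Polynomial K)),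
      F.eval₂ ψ w ∈ Algebra.adjoin K {u, v, w} := by
    intro F
    rw [Polynomial.eval₂_eq_sum_range]
    refine sum_mem fun i _ => mul_mem ?_ (pow_mem (Algebra.subset_adjoin (by simp)) i)
    rw [hψe]
    exact hev _ _ _ (by simp) (Algebra.subset_adjoin (by simp))
  have hB2 : ∀ a ∈ Algebra.adjoin K {u, v, w},
      ∃ F : Polynomial (Polynomial (Polynomial K)), F.eval₂ ψ w = a := by
    intro a ha
    induction ha using Algebra.adjoin_induction with
    | mem x hx =>
      simp only [Set.mem_insert_iff, Set.mem_singleton_iff] at hx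
      rcases hx with rfl | rfl | rfl
      · exact ⟨Polynomial.C (Polynomial.C Polynomial.X), by
          rw [Polynomial.eval₂_C, hψC, Polynomial.aeval_X]⟩
      · exact ⟨Polynomial.C Polynomial.X, by rw [Polynomial.eval₂_C]; simp [hψ]⟩
      · exact ⟨Polynomial.X, by simp⟩
    | algebraMap r =>
      exact ⟨Polynomial.C (Polynomial.C (Polynomial.C r)), by
          rw [Polynomial.eval₂_C, hψC, Polynomial.aeval_C]⟩
    | add x y _ _ hx hy =>
      obtain ⟨F, rfl⟩ := hx
      obtain ⟨G, rfl⟩ := hy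
      exact ⟨F + G, Polynomial.eval₂_add _ _⟩
    | mul x y _ _ hx hy =>
      obtain ⟨F, rfl⟩ := hx
      obtain ⟨G, rfl⟩ := hy
      exact ⟨F * G, Polynomial.eval₂_mul _ _⟩
  have hpB : p ∈ Algebra.adjoin K {u, v, w} := by
    have : p = Polynomial.aeval u c * w - ev2 K u v Q := by rw [← hH]; ring
    rw [this]
    exact sub_mem (mul_mem (hau _ _ (by simp)) (Algebra.subset_adjoin (by simp)))
      (hev _ _ _ (by simp) (Algebra.subset_adjoin (by simp)))
  have hsB : s ∈ Algebra.adjoin K {u, v, w} := by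
    rw [hvdef]
    exact sub_mem (Algebra.subset_adjoin (by simp)) (hev _ _ _ (by simp) hpB)
  have hle : Algebra.adjoin K {u, p, s} ≤ Algebra.adjoin K {u, v, w} := by
    rw [Algebra.adjoin_le_iff]
    rintro x hx
    simp only [Set.mem_insert_iff, Set.mem_singleton_iff] at hx
    rcases hx with rfl | rfl | rfl
    · exact Algebra.subset_adjoin (by simp)
    · exact hpB
    · exact hsB
  -- saturation at an irreducible factor of `c`
  have hsat : ∀ q : Polynomial K, Irreducible q → q ∣ c → ∀ a : PolyR K,
      Polynomial.aeval u q * a ∈ Algebra.adjoin K {u, v, w} →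
      a ∈ Algebra.adjoin K {u, v, w} := by
    intro q hq hqc
    obtain ⟨hprime, hred⟩ := exists_reduction u hu q hq
    obtain ⟨c', hc'⟩ := hqc
    have hq0 : Polynomial.aeval u q ≠ 0 := hprime.ne_zero
    have hcq : Polynomial.aeval u c = Polynomial.aeval u q * Polynomial.aeval u c' := by
      rw [hc', map_mul]
    have claim1 : ∀ P : Polynomial (Polynomial K), Polynomial.aeval u q ∣ ψ P →
        Polynomial.C q ∣ P := by
      intro P hP
      by_contra hcon
      obtain ⟨r, v', hv'⟩ := hred v P hcon hP
      have hX : X v' = Polynomial.aeval u c' := by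
        have := congrArg X hv'
        rw [map_sub, hXv, X_aeval X u hXu, sub_zero, Derivation.leibniz, X_aeval X u hXu,
          hcq] at this
        simp only [smul_eq_mul, mul_zero, add_zero] at this
        exact (mul_left_cancel₀ hq0 this).symm
      have hc'0 : Polynomial.aeval u c' ≠ 0 := by
        intro h0; rw [h0, mul_zero] at hcq; exact hc0 hcq
      obtain ⟨μ, hμ⟩ := hmin v' ⟨by rw [hX]; exact hc'0, by rw [hX, X_aeval X u hXu]⟩
        ⟨Polynomial.aeval u q, by rw [hc, hX, hcq]; ring⟩
      rw [hX, hc, hcq] at hμ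
      apply hprime.not_unit
      refine IsUnit.of_mul_eq_one (μ : PolyR K) (mul_left_cancel₀ hc'0 ?_)
      rw [mul_one]
      conv_rhs => rw [hμ]
      ring
    have claim3 : ¬ Polynomial.aeval u q ∣ X w := by
      intro hd
      rw [hXw, ← hψe] at hd
      obtain ⟨G, hG⟩ := dvd_of_derivative (K := K) q Q (claim1 _ hd)
      have hQ : ev2 K u v Q = Polynomial.aeval u (Q.coeff 0) + Polynomial.aeval u q * ψ G := by
        rw [← hψe]
        conv_lhs => rw [hG]
        rw [map_add, map_mul, hψC, hψC]
      have h1 : p + Polynomial.aeval u (Q.coeff 0) =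
          Polynomial.aeval u q * (Polynomial.aeval u c' * w - ψ G) := by
        rw [hQ, hcq] at hH
        linear_combination hH
      refine p_not_dvd u p s hind q (Q.coeff 0) hq.not_isUnit _ (hker1 _ ?_) h1
      have h2 := congrArg X h1
      rw [map_add, hXp, X_aeval X u hXu, Derivation.leibniz, X_aeval X u hXu] at h2
      simp only [smul_eq_mul, mul_zero, add_zero] at h2
      exact (mul_eq_zero.1 h2.symm).resolve_left hq0
    have claim2 : ∀ (n : ℕ) (F : Polynomial (Polynomial (Polynomial K))), F.natDegree ≤ n →
        Polynomial.aeval u q ∣ F.eval₂ ψ w → Polynomial.C (Polynomial.C q) ∣ F := by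
      intro n
      induction n with
      | zero =>
        intro F hF hd
        rw [Polynomial.eq_C_of_natDegree_le_zero hF] at hd ⊢
        rw [Polynomial.eval₂_C] at hd
        exact map_dvd Polynomial.C (claim1 _ hd)
      | succ n ih =>
        intro F hF hd
        have hch := chain_mod X ψ (Polynomial.aeval u q) (fun r => by
          rw [hψe, X_ev2 X u v hXu, hXv, hcq]
          exact (dvd_mul_right _ _).mul_left _) w F
        have hXd : Polynomial.aeval u q ∣ X (F.eval₂ ψ w) := by
          obtain ⟨b, hb⟩ := hd
          rw [hb, Derivation.leibniz, X_aeval X u hXu]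
          simp
        have h1 := (dvd_sub_right hXd).1 hch
        have h2 := (hprime.dvd_or_dvd h1).resolve_right claim3
        have h3 := ih _ (by
          have := Polynomial.natDegree_derivative_le F
          omega) h2
        obtain ⟨G, hG⟩ := dvd_of_derivative (K := K) (Polynomial.C q) F h3
        rw [hG] at hd
        rw [Polynomial.eval₂_add, Polynomial.eval₂_mul, Polynomial.eval₂_C, Polynomial.eval₂_C,
          hψC] at hd
        have h4 := (dvd_add_left (dvd_mul_right _ _)).1 hd
        rw [hG]
        exact dvd_add (map_dvd Polynomial.C (claim1 _ h4)) (dvd_mul_right _ _)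
    intro a ha
    obtain ⟨F, hF⟩ := hB2 _ ha
    obtain ⟨G, rfl⟩ := claim2 F.natDegree F le_rfl ⟨a, hF⟩
    rw [Polynomial.eval₂_mul, Polynomial.eval₂_C, hψC] at hF
    rw [← mul_left_cancel₀ hq0 hF]
    exact hB1 G
  have hcne : c ≠ 0 := by rintro rfl; simp at hc0
  have hsat2 : ∀ d : Polynomial K, d ∣ c → ∀ a : PolyR K,
      Polynomial.aeval u d * a ∈ Algebra.adjoin K {u, v, w} →
      a ∈ Algebra.adjoin K {u, v, w} := by
    intro d
    induction d using WfDvdMonoid.induction_on_irreducible with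
    | zero => intro h; exact absurd (zero_dvd_iff.1 h) hcne
    | unit e he =>
      intro _ a ha
      obtain ⟨f, hf⟩ := he.exists_left_inv
      have h1 : a = Polynomial.aeval u f * (Polynomial.aeval u e * a) := by
        rw [← mul_assoc, ← map_mul, hf, map_one, one_mul]
      rw [h1]
      exact mul_mem (hau _ _ (by simp)) ha
    | mul d q hd0 hq ih =>
      intro hdvd a ha
      rw [map_mul, mul_assoc] at ha
      exact ih (dvd_of_mul_left_dvd hdvd) a
        (hsat q hq (dvd_of_mul_right_dvd hdvd) _ ha)
  have hsat3 : ∀ (N : ℕ) (a : PolyR K),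
      (Polynomial.aeval u c) ^ N * a ∈ Algebra.adjoin K {u, v, w} →
      a ∈ Algebra.adjoin K {u, v, w} := by
    intro N
    induction N with
    | zero => intro a ha; simpa using ha
    | succ N ih =>
      intro a ha
      rw [pow_succ, mul_assoc] at ha
      exact hsat2 c dvd_rfl a (ih _ ha)
  rw [IsCoordSys, eq_top_iff]
  intro a _
  obtain ⟨N, hN⟩ := hloc a
  exact hsat3 N a (hle hN)

end
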